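/- arXiv:1501.01451 — 4 statements merged into one kernel-verified Lean document; each statement's English description precedes it below -/
import Mathlib

section
/- Let C be a nonempty closed convex subset of ℝⁿ, let Q₀ > 0, and define the prox-function Q(z) = ½‖z‖₂² + Q₀ and, for γ ∈ ℝ and h ∈ ℝⁿ, the function E_{γ,h}(x) = −(γ + ⟨h,x⟩)/Q(x) on C. Suppose u ∈ C maximizes E_{γ,h} over C and that e := E_{γ,h}(u) > 0. Then u = P_C(−e⁻¹ h), where P_C denotes the orthogonal projection onto C; moreover e satisfies the scalar equation φ(e) = 0, where φ(e) := e(½‖P_C(−e⁻¹h)‖₂² + Q₀) + γ + ⟨h, P_C(−e⁻¹h)⟩. -/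
open scoped RealInnerProductSpace

/-- `p` is the orthogonal projection of `y` onto `C`: it lies in `C` and minimizes
`½‖x − y‖²` over `x ∈ C`. -/
def IsProjOn {n : ℕ} (C : Set (EuclideanSpace ℝ (Fin n)))
    (y p : EuclideanSpace ℝ (Fin n)) : Prop :=
  p ∈ C ∧ ∀ x ∈ C, 1 / 2 * ‖p - y‖ ^ 2 ≤ 1 / 2 * ‖x - y‖ ^ 2

theorem stmt_0 {n : ℕ} (C : Set (EuclideanSpace ℝ (Fin n)))
    (hCne : C.Nonempty) (hCcl : IsClosed C) (hCcv : Convex ℝ C)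
    (Q₀ : ℝ) (hQ₀ : 0 < Q₀)
    (Q : EuclideanSpace ℝ (Fin n) → ℝ) (hQ : ∀ z, Q z = 1 / 2 * ‖z‖ ^ 2 + Q₀)
    (γ : ℝ) (h : EuclideanSpace ℝ (Fin n))
    (E : EuclideanSpace ℝ (Fin n) → ℝ) (hE : ∀ x, E x = -(γ + ⟪h, x⟫) / Q x)
    (u : EuclideanSpace ℝ (Fin n)) (huC : u ∈ C)
    (hmax : ∀ x ∈ C, E x ≤ E u)
    (e : ℝ) (he : e = E u) (hepos : 0 < e) :
    IsProjOn C (-(e⁻¹) • h) u ∧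
      e * (1 / 2 * ‖u‖ ^ 2 + Q₀) + γ + ⟪h, u⟫ = 0 := by
  have hQpos : ∀ z, 0 < Q z := fun z => by rw [hQ]; positivity
  have heq : e * (1 / 2 * ‖u‖ ^ 2 + Q₀) + γ + ⟪h, u⟫ = 0 := by
    have key := he.trans (hE u)
    rw [eq_div_iff (hQpos u).ne', hQ] at key
    linarith
  refine ⟨⟨huC, fun x hx => ?_⟩, heq⟩
  have hle : -(γ + ⟪h, x⟫) ≤ e * (1 / 2 * ‖x‖ ^ 2 + Q₀) := by
    have hx' := hmax x hx
    rwa [← he, hE, div_le_iff₀ (hQpos x), hQ] at hx'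
  have expand : ∀ z : EuclideanSpace ℝ (Fin n), ‖z - -(e⁻¹) • h‖ ^ 2 =
      e⁻¹ * (e * ‖z‖ ^ 2 + 2 * ⟪h, z⟫) + ‖e⁻¹ • h‖ ^ 2 := fun z => by
    rw [neg_smul, sub_neg_eq_add, norm_add_sq_real, real_inner_smul_right, real_inner_comm]
    field_simp
  rw [expand, expand]
  gcongr 1 / 2 * (e⁻¹ * ?_ + _)
  linarith
end

section
/- Let A be an m×n real matrix, B an n×m real matrix satisfying the Moore–Penrose conditions A B A = A, B A B = B, (A B)ᵀ = A B, (B A)ᵀ = B A, and let b ∈ ℝᵐ lie in the range of A, so that C = {x ∈ ℝⁿ : A x = b} is nonempty. Then for every y ∈ ℝⁿ, the orthogonal projection of y onto C is P_C(y) = y − B(A y − b). Moreover, for γ ∈ ℝ, h ∈ ℝⁿ, Q₀ > 0 and e > 0, the equation e(½‖P_C(−e⁻¹h)‖₂² + Q₀) + γ + ⟨h, P_C(−e⁻¹h)⟩ = 0 is equivalent to the quadratic equation β₁ e² + β₂ e + β₃ = 0 with β₁ = ½‖B b‖₂² + Q₀, β₂ = γ + ⟨B(A h), B b⟩, β₃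 = ½‖B(A h)‖₂² − ½‖h‖₂². -/
open scoped RealInnerProductSpace
open Matrix

theorem toEuclideanLin_mul_apply {k m n : ℕ} (A : Matrix (Fin k) (Fin m) ℝ)
    (B : Matrix (Fin m) (Fin n) ℝ) (x : EuclideanSpace ℝ (Fin n)) :
    toEuclideanLin (A * B) x = toEuclideanLin A (toEuclideanLin B x) := by
  simp [toLpLin_apply, mulVec_mulVec]

theorem inner_toEuclideanLin_of_transpose_eq {n : ℕ} {M : Matrix (Fin n) (Fin n) ℝ}
    (hM : Mᵀ = M) (x y : EuclideanSpace ℝ (Fin n)) :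
    ⟪toEuclideanLin M x, y⟫ = ⟪x, toEuclideanLin M y⟫ := by
  have hH : M.IsHermitian := by rw [IsHermitian, conjTranspose_eq_transpose_of_trivial, hM]
  exact isSymmetric_toEuclideanLin_iff.mpr hH x y

theorem stmt_1 {m n : ℕ} (A : Matrix (Fin m) (Fin n) ℝ) (B : Matrix (Fin n) (Fin m) ℝ)
    (hABA : A * B * A = A) (hBAB : B * A * B = B)
    (hABs : (A * B)ᵀ = A * B) (hBAs : (B * A)ᵀ = B * A)
    (A' : EuclideanSpace ℝ (Fin n) →ₗ[ℝ] EuclideanSpace ℝ (Fin m))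
    (B' : EuclideanSpace ℝ (Fin m) →ₗ[ℝ] EuclideanSpace ℝ (Fin n))
    (hA' : A' = Matrix.toEuclideanLin A) (hB' : B' = Matrix.toEuclideanLin B)
    (b : EuclideanSpace ℝ (Fin m)) (hb : ∃ x, A' x = b)
    (C : Set (EuclideanSpace ℝ (Fin n))) (hC : C = {x | A' x = b})
    (γ : ℝ) (h : EuclideanSpace ℝ (Fin n)) (Q₀ : ℝ) (hQ₀ : 0 < Q₀) :
    (∀ y : EuclideanSpace ℝ (Fin n), IsProjOn C y (y - B' (A' y - b))) ∧
      ∀ e : ℝ, 0 < e →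
        (e * (1 / 2 * ‖(-(e⁻¹) • h) - B' (A' (-(e⁻¹) • h) - b)‖ ^ 2 + Q₀) + γ +
            ⟪h, (-(e⁻¹) • h) - B' (A' (-(e⁻¹) • h) - b)⟫ = 0 ↔
          (1 / 2 * ‖B' b‖ ^ 2 + Q₀) * e ^ 2 + (γ + ⟪B' (A' h), B' b⟫) * e +
            (1 / 2 * ‖B' (A' h)‖ ^ 2 - 1 / 2 * ‖h‖ ^ 2) = 0) := by
  have hAB : ∀ x, A' (B' (A' x)) = A' x := fun x => by
    rw [hA', hB', ← toEuclideanLin_mul_apply, ← toEuclideanLin_mul_apply, hABA]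
  have hsymm : ∀ x y, ⟪B' (A' x), y⟫ = ⟪x, B' (A' y)⟫ := fun x y => by
    simp only [hA', hB', ← toEuclideanLin_mul_apply]
    exact inner_toEuclideanLin_of_transpose_eq hBAs x y
  obtain ⟨x₀, rfl⟩ := hb
  subst hC
  refine ⟨fun y => ⟨by simp [hAB], fun x hx => ?_⟩, fun e he => ?_⟩
  · have hx : A' x = A' x₀ := hx
    have horth : ⟪x - y + B' (A' (y - x)), B' (A' (y - x))⟫ = 0 := by
      rw [← hsymm]
      simp [hAB]
    have hsplit : x - y = (x - y + B' (A' (y - x))) - B' (A' (y - x)) := by abel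
    have hnorm := norm_sub_sq_real (x - y + B' (A' (y - x))) (B' (A' (y - x)))
    rw [← hsplit, horth] at hnorm
    have hp : y - B' (A' y - A' x₀) - y = -B' (A' (y - x)) := by
      rw [map_sub A', hx]
      abel
    rw [hp, norm_neg, hnorm]
    nlinarith [sq_nonneg ‖x - y + B' (A' (y - x))‖]
  · set w := B' (A' h) with hw
    set u := B' (A' x₀) with hu
    have hhu : ⟪h, u⟫ = ⟪w, u⟫ := by rw [hw, hsymm, hu, hAB]
    have hhw : ⟪h, w⟫ = ‖w‖ ^ 2 := by
      rw [← real_inner_self_eq_norm_sq, hw, hsymm, hAB]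
    have hp : -(e⁻¹) • h - B' (A' (-(e⁻¹) • h) - A' x₀) = u - e⁻¹ • (h - w) := by
      simp only [map_sub, map_smul, ← hw, ← hu]
      module
    have hnorm : ‖u - e⁻¹ • (h - w)‖ ^ 2 = ‖u‖ ^ 2 + e⁻¹ ^ 2 * (‖h‖ ^ 2 - ‖w‖ ^ 2) := by
      rw [norm_sub_sq_real, norm_smul, mul_pow, norm_sub_sq_real, inner_smul_right, inner_sub_right,
        real_inner_comm, hhu, real_inner_comm, hhw, Real.norm_eq_abs, sq_abs]
      ring
    have hinner : ⟪h, u - e⁻¹ • (h - w)⟫ = ⟪w, u⟫ - e⁻¹ * (‖h‖ ^ 2 - ‖w‖ ^ 2) := by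
      rw [inner_sub_right, inner_smul_right, inner_sub_right, hhu, hhw, real_inner_self_eq_norm_sq]
    rw [hp, hnorm, hinner, ← mul_eq_zero_iff_left he.ne']
    refine Eq.congr ?_ rfl
    field_simp
    ring
end

section
/- Let ξ > 0, C = {x ∈ ℝⁿ : ‖x‖₂ ≤ ξ} the Euclidean ball, γ ∈ ℝ, h ∈ ℝⁿ with h ≠ 0, and Q₀ > 0. Let e₁ = (−γ + √(γ² + 2Q₀‖h‖₂²))/(2Q₀) be the positive root of Q₀ e² + γ e − ½‖h‖₂² = 0. (i) If ‖h‖₂ ≤ e₁ ξ, then the point u = −e₁⁻¹ h lies in C and satisfies e₁(½‖u‖₂² + Q₀) + γ + ⟨h, u⟩ = 0. (ii) Otherwise, the point u = −(ξ/‖h‖₂) h lies in C with ‖u‖₂ = ξ, and e = 2(ξ‖h‖₂ − γ)/(ξ² + 2Q₀) satisfies e(½‖u‖₂² + Q₀) + γ + ⟨h, u⟩ = 0. -/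
open scoped RealInnerProductSpace

theorem stmt_5 {n : ℕ} (ξ : ℝ) (hξ : 0 < ξ)
    (C : Set (EuclideanSpace ℝ (Fin n))) (hC : C = {x | ‖x‖ ≤ ξ})
    (γ : ℝ) (h : EuclideanSpace ℝ (Fin n)) (hh : h ≠ 0) (Q₀ : ℝ) (hQ₀ : 0 < Q₀)
    (e₁ : ℝ) (he₁ : e₁ = (-γ + Real.sqrt (γ ^ 2 + 2 * Q₀ * ‖h‖ ^ 2)) / (2 * Q₀)) :
    (‖h‖ ≤ e₁ * ξ →
      (-(e₁⁻¹) • h) ∈ C ∧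
        e₁ * (1 / 2 * ‖(-(e₁⁻¹) • h : EuclideanSpace ℝ (Fin n))‖ ^ 2 + Q₀) + γ +
          ⟪h, -(e₁⁻¹) • h⟫ = 0) ∧
    (¬ ‖h‖ ≤ e₁ * ξ →
      (-(ξ / ‖h‖) • h) ∈ C ∧ ‖(-(ξ / ‖h‖) • h : EuclideanSpace ℝ (Fin n))‖ = ξ ∧
        (2 * (ξ * ‖h‖ - γ) / (ξ ^ 2 + 2 * Q₀)) *
            (1 / 2 * ‖(-(ξ / ‖h‖) • h : EuclideanSpace ℝ (Fin n))‖ ^ 2 + Q₀) + γ +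
          ⟪h, -(ξ / ‖h‖) • h⟫ = 0) := by
  have hN : 0 < ‖h‖ := norm_pos_iff.mpr hh
  subst hC
  refine ⟨fun hle => ?_, fun _ => ?_⟩
  · have he : 0 < e₁ := pos_of_mul_pos_left (hN.trans_le hle) hξ.le
    have hroot : Q₀ * e₁ ^ 2 + γ * e₁ - 1 / 2 * ‖h‖ ^ 2 = 0 := by
      have hsq := Real.sq_sqrt (show 0 ≤ γ ^ 2 + 2 * Q₀ * ‖h‖ ^ 2 by positivity)
      rw [he₁]
      generalize √(γ ^ 2 + 2 * Q₀ * ‖h‖ ^ 2) = s at hsq ⊢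
      field_simp
      linear_combination hsq
    have hnorm : ‖-(e₁⁻¹) • h‖ = ‖h‖ / e₁ := by
      rw [norm_smul, norm_neg, norm_inv, Real.norm_of_nonneg he.le, div_eq_inv_mul]
    refine ⟨?_, ?_⟩
    · rw [Set.mem_ofPred_eq, hnorm, div_le_iff₀ he, mul_comm]
      exact hle
    · rw [hnorm, inner_smul_right, real_inner_self_eq_norm_sq]
      field_simp
      linear_combination 2 * hroot
  · have hnorm : ‖-(ξ / ‖h‖) • h‖ = ξ := by
      rw [norm_smul, norm_neg, Real.norm_of_nonneg (by positivity), div_mul_cancel₀ _ hN.ne']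
    refine ⟨hnorm.le, hnorm, ?_⟩
    rw [hnorm, inner_smul_right, real_inner_self_eq_norm_sq]
    field_simp
    ring
end

section
/- Let C be a nonempty closed convex subset of ℝⁿ, Q₀ > 0, Q(x) = ½‖x‖₂² + Q₀, γ ∈ ℝ, h ∈ ℝⁿ, and define E_{γ,h}(x) = −(γ + ⟨h,x⟩)/Q(x). If u ∈ C maximizes E_{γ,h} over C with e := E_{γ,h}(u) > 0, then e·Q(u) = −γ − ⟨h,u⟩ and the variational inequality ⟨e u + h, z − u⟩ ≥ 0 holds for all z ∈ C. -/
open scoped RealInnerProductSpace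

/-- If `a + t * b ≥ 0` for all `t ∈ (0, 1]`, where `b ≥ 0`, then `a ≥ 0`. -/
theorem nonneg_of_forall_add_mul_nonneg {a b : ℝ} (hb : 0 ≤ b)
    (hab : ∀ t : ℝ, 0 < t → t ≤ 1 → 0 ≤ a + t * b) : 0 ≤ a := by
  by_contra! ha
  have hba : 0 < b - a := by linarith
  have key := hab (-a / (b - a)) (div_pos (by linarith) hba)
    ((div_le_one hba).2 (by linarith))
  have hval : a + -a / (b - a) * b = -(a ^ 2 / (b - a)) := by
    field_simp
    ring
  have hpos : 0 < a ^ 2 / (b - a) := div_pos (sq_pos_of_neg ha) hba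
  linarith

theorem stmt_19 {n : ℕ} (C : Set (EuclideanSpace ℝ (Fin n)))
    (hCne : C.Nonempty) (hCcl : IsClosed C) (hCcv : Convex ℝ C)
    (Q₀ : ℝ) (hQ₀ : 0 < Q₀)
    (Q : EuclideanSpace ℝ (Fin n) → ℝ) (hQ : ∀ x, Q x = 1 / 2 * ‖x‖ ^ 2 + Q₀)
    (γ : ℝ) (h : EuclideanSpace ℝ (Fin n))
    (E : EuclideanSpace ℝ (Fin n) → ℝ) (hE : ∀ x, E x = -(γ + ⟪h, x⟫) / Q x)
    (u : EuclideanSpace ℝ (Fin n)) (huC : u ∈ C)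
    (hmax : ∀ x ∈ C, E x ≤ E u)
    (e : ℝ) (he : e = E u) (hepos : 0 < e) :
    e * Q u = -γ - ⟪h, u⟫ ∧ ∀ z ∈ C, ⟪e • u + h, z - u⟫ ≥ 0 := by
  have hQpos : ∀ x, 0 < Q x := fun x => by
    rw [hQ]
    positivity
  have heq : e * Q u = -γ - ⟪h, u⟫ := by
    rw [he, hE, div_mul_cancel₀ _ (hQpos u).ne']
    ring
  refine ⟨heq, fun z hz => ?_⟩
  have hge : ∀ x ∈ C, -(γ + ⟪h, x⟫) ≤ e * Q x := fun x hx => by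
    have hle := hmax x hx
    rwa [← he, hE, div_le_iff₀ (hQpos x)] at hle
  refine nonneg_of_forall_add_mul_nonneg (b := e / 2 * ‖z - u‖ ^ 2) (by positivity)
    fun t ht ht1 => ?_
  have hx := hge _ (hCcv.add_smul_sub_mem huC hz ⟨ht.le, ht1⟩)
  rw [hQ, norm_add_sq_real, norm_smul, mul_pow, Real.norm_eq_abs, sq_abs, inner_add_right,
    real_inner_smul_right, real_inner_smul_right] at hx
  rw [hQ] at heq
  rw [inner_add_left, real_inner_smul_left]
  refine nonneg_of_mul_nonneg_right ?_ ht
  linarith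
end
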